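/- arXiv:0710.3232 — 2 statements merged into one kernel-verified Lean document; each statement's English description precedes it below -/
import Mathlib

section
/- Let G ≤ GL_n(F) be a finite reflection group with reflection arrangement 𝒜. If ω₁,...,ωₙ are G-invariant differential 1-forms, then the product Q(Ã)·Q_det = ∏_{H∈𝒜} l_H^{e_H b_H + e_H − 1} divides the polynomial f defined by ω₁ ∧ ... ∧ ωₙ = f · dz₁∧...∧dzₙ. -/
open MvPolynomial

abbrev GLn (F : Type*) [Field F] (n : ℕ) := (Fin n → F) ≃ₗ[F] (Fin n → F)

variable {F : Type*} [Field F] {n : ℕ}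

/-- Matrix of the contragredient action of `g` on the coordinate functions:
`g · z_i = ∑ j (actMat g i j) z_j`. -/
noncomputable def actMat (g : GLn F n) : Matrix (Fin n) (Fin n) F :=
  Matrix.of fun i j => g.symm (Pi.single j 1) i

/-- Action of `g ∈ GL(V)` on polynomials `F[V]` (contragredient action). -/
noncomputable def polyAct (g : GLn F n) : MvPolynomial (Fin n) F →ₐ[F] MvPolynomial (Fin n) F :=
  aeval fun i => ∑ j, C (actMat g i j) * X j

/-- The degree-one polynomial corresponding to a linear form on `V`. -/
noncomputable def linToPoly (z : (Fin n → F) →ₗ[F] F) : MvPolynomial (Fin n) F :=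
  ∑ j, C (z (Pi.single j 1)) * X j

/-- The invariant ring `F[V]^G` as a subalgebra of `F[V]`. -/
noncomputable def invSub (G : Subgroup (GLn F n)) : Subalgebra F (MvPolynomial (Fin n) F) where
  carrier := {f | ∀ g ∈ G, polyAct g f = f}
  add_mem' := fun {a b} ha hb g hg => by rw [map_add, ha g hg, hb g hg]
  mul_mem' := fun {a b} ha hb g hg => by rw [map_mul, ha g hg, hb g hg]
  algebraMap_mem' := fun r g hg => (polyAct g).commutes r

/-- Action of `g` on a differential 1-form `ω = ∑ i (w i) dz_i`; the result is the
coefficient vector of `g · ω`. -/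
noncomputable def oneFormAct (g : GLn F n) (w : Fin n → MvPolynomial (Fin n) F) :
    Fin n → MvPolynomial (Fin n) F :=
  fun j => ∑ i, polyAct g (w i) * C (actMat g i j)

/-- The coefficient of `dz_J` in `g · dz_I` (a minor determinant of `actMat g`). -/
noncomputable def minorDet (g : GLn F n) (I J : Finset (Fin n)) : F :=
  if h : J.card = I.card then
    Matrix.det (Matrix.of fun a b : Fin I.card =>
      actMat g (I.orderIsoOfFin rfl a) (J.orderIsoOfFin h b))
  else 0

/-- Action of `g` on a differential form `μ = ∑_I u_I dz_I`, given by its coefficient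
function `u : Finset (Fin n) → F[V]`. -/
noncomputable def formAct (g : GLn F n) (u : Finset (Fin n) → MvPolynomial (Fin n) F) :
    Finset (Fin n) → MvPolynomial (Fin n) F :=
  fun J => ∑ I : Finset (Fin n), polyAct g (u I) * C (minorDet g I J)

/-- The sign arising when wedging `dz_I ∧ dz_J` into `dz_(I ∪ J)` for disjoint `I`, `J`. -/
def wsign (I J : Finset (Fin n)) : ℤ :=
  (-1) ^ ((I ×ˢ J).filter fun p => p.2 < p.1).card

/-- Wedge product of differential forms in terms of coefficient functions. -/
noncomputable def wedgeF (u v : Finset (Fin n) → MvPolynomial (Fin n) F) :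
    Finset (Fin n) → MvPolynomial (Fin n) F :=
  fun K => ∑ I ∈ K.powerset, wsign I (K \ I) • (u I * v (K \ I))

/-- The constant 0-form `1`. -/
noncomputable def unitForm : Finset (Fin n) → MvPolynomial (Fin n) F :=
  fun S => if S = ∅ then 1 else 0

/-- Iterated wedge product of a list of forms. -/
noncomputable def iterWedge (L : List (Finset (Fin n) → MvPolynomial (Fin n) F)) :
    Finset (Fin n) → MvPolynomial (Fin n) F :=
  L.foldr wedgeF unitForm

/-- A 1-form, viewed as a differential form via its coefficient function. -/
noncomputable def oneToForm (w : Fin n → MvPolynomial (Fin n) F) :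
    Finset (Fin n) → MvPolynomial (Fin n) F :=
  fun S => if h : S.card = 1 then w (S.min' (Finset.card_pos.mp (by omega))) else 0

/-- The fixed space of `g` in `V`. -/
noncomputable def fixedSpace (g : GLn F n) : Submodule F (Fin n → F) :=
  LinearMap.ker (g.toLinearMap - LinearMap.id)

/-- A reflection: an element of finite order whose fixed space is a hyperplane. -/
def IsReflection (g : GLn F n) : Prop :=
  IsOfFinOrder g ∧ Module.finrank F (fixedSpace g) = n - 1

/-- A transvection: a (necessarily nondiagonalizable) reflection of determinant one. -/
def IsTransvection (g : GLn F n) : Prop :=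
  IsReflection g ∧ LinearMap.det g.toLinearMap = 1 ∧ g ≠ 1

/-- The pointwise stabilizer `G_H` of a subspace `H` in `G`. -/
def pointStab (G : Subgroup (GLn F n)) (H : Submodule F (Fin n → F)) : Subgroup (GLn F n) where
  carrier := {g | g ∈ G ∧ ∀ v ∈ H, g v = v}
  one_mem' := ⟨G.one_mem, fun v _ => rfl⟩
  mul_mem' := fun {a b} ha hb => ⟨G.mul_mem ha.1 hb.1, fun v hv => by
    show a (b v) = v
    rw [hb.2 v hv, ha.2 v hv]⟩
  inv_mem' := fun {a} ha => ⟨G.inv_mem ha.1, fun v hv => by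
    show a.symm v = v
    conv_lhs => rw [← ha.2 v hv]
    exact a.symm_apply_apply v⟩

/-- `K_H`: the subgroup of `G_H` of elements of determinant one
(the transvections in `G_H` together with the identity). -/
noncomputable def KH (G : Subgroup (GLn F n)) (H : Submodule F (Fin n → F)) :
    Subgroup (GLn F n) :=
  pointStab G H ⊓ MonoidHom.ker LinearEquiv.det

/-- `e_H = |G_H : K_H|`. -/
noncomputable def eH (G : Subgroup (GLn F n)) (H : Submodule F (Fin n → F)) : ℕ :=
  ((KH G H).subgroupOf (pointStab G H)).index

/-- The transvection root space of `G_H`: the span of the root vectors of the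
transvections in `G_H` (the root vector of `t` spans the range of `t - 1`). -/
noncomputable def trvSpace (G : Subgroup (GLn F n)) (H : Submodule F (Fin n → F)) :
    Submodule F (Fin n → F) :=
  ⨆ g ∈ {g : GLn F n | g ∈ pointStab G H ∧ IsTransvection g},
    LinearMap.range (g.toLinearMap - LinearMap.id)

/-- `b_H`: the dimension of the transvection root space of `G_H`. -/
noncomputable def bH (G : Subgroup (GLn F n)) (H : Submodule F (Fin n → F)) : ℕ :=
  Module.finrank F (trvSpace G H)

lemma linearForm_apply_eq_sum (z : (Fin n → F) →ₗ[F] F) (v : Fin n → F) :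
    z v = ∑ j, v j * z (Pi.single j 1) := by
  conv_lhs => rw [← Finset.univ_sum_single v, map_sum]
  refine Finset.sum_congr rfl fun j _ => ?_
  rw [← smul_eq_mul, ← map_smul, ← Pi.single_smul, smul_eq_mul, mul_one]

/-- A linear form, viewed as a polynomial, evaluates as the form itself. -/
lemma eval_linToPoly (z : (Fin n → F) →ₗ[F] F) (v : Fin n → F) :
    MvPolynomial.eval v (linToPoly z) = z v := by
  rw [linToPoly, map_sum, linearForm_apply_eq_sum z v]
  exact Finset.sum_congr rfl fun j _ => by rw [map_mul, eval_C, eval_X, mul_comm]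

lemma irreducible_linToPoly {z : (Fin n → F) →ₗ[F] F} (hz : z ≠ 0) :
    Irreducible (linToPoly z) := by
  obtain ⟨j, hj⟩ : ∃ j, z (Pi.single j 1) ≠ 0 := by
    by_contra! h
    exact hz (LinearMap.pi_ext' fun j => LinearMap.ext_ring (by simpa using h j))
  let c : Fin n →₀ F := Finsupp.equivFunOnFinite.symm fun j => z (Pi.single j 1)
  have hc : sumSMulX c = linToPoly z := by
    rw [sumSMulX, Finsupp.linearCombination_apply, Finsupp.sum_fintype _ _ (by simp), linToPoly]
    simp [c, smul_eq_C_mul]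
  rw [← hc]
  refine irreducible_sumSMulX c ⟨j, Finsupp.mem_support_iff.2 hj⟩ fun r hr => ?_
  exact isUnit_of_dvd_unit (hr j) (isUnit_iff_ne_zero.2 hj)

lemma isRelPrime_linToPoly {z z' : (Fin n → F) →ₗ[F] F} (hz : z ≠ 0) (hz' : z' ≠ 0)
    (h : LinearMap.ker z ≠ LinearMap.ker z') : IsRelPrime (linToPoly z) (linToPoly z') := by
  rw [(irreducible_linToPoly hz).isRelPrime_iff_not_dvd]
  rintro ⟨q, hq⟩
  refine h (Submodule.eq_of_le_of_finrank_eq (fun v hv => ?_) ?_)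
  · rw [LinearMap.mem_ker] at hv ⊢
    rw [← eval_linToPoly, hq, map_mul, eval_linToPoly, hv, zero_mul]
  · have h1 := Module.Dual.finrank_ker_add_one_of_ne_zero hz
    have h2 := Module.Dual.finrank_ker_add_one_of_ne_zero hz'
    omega

lemma polyAct_linToPoly (g : GLn F n) (z : (Fin n → F) →ₗ[F] F) :
    polyAct g (linToPoly z) = linToPoly (z ∘ₗ g.symm.toLinearMap) := by
  simp only [linToPoly, map_sum, map_mul, polyAct, aeval_X, algHom_C, algebraMap_eq,
    Finset.mul_sum]
  rw [Finset.sum_comm]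
  refine Finset.sum_congr rfl fun k _ => ?_
  simp only [← mul_assoc, ← Finset.sum_mul, ← C_mul, ← map_sum]
  congr 2
  rw [LinearMap.comp_apply, linearForm_apply_eq_sum z]
  exact Finset.sum_congr rfl fun j _ => mul_comm _ _

/-- An invariant 1-form, regarded as a linear map from `V` to polynomials, is equivariant. -/
lemma linearCombination_apply_of_invariant {g : GLn F n} {w : Fin n → MvPolynomial (Fin n) F}
    (hw : oneFormAct g w = w) (v : Fin n → F) :
    Fintype.linearCombination F w (g v) = polyAct g (Fintype.linearCombination F w v) := by
  have key : Fintype.linearCombination F w =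
      (polyAct g).toLinearMap ∘ₗ Fintype.linearCombination F w ∘ₗ g.symm.toLinearMap := by
    refine LinearMap.pi_ext' fun j => LinearMap.ext_ring ?_
    have := congrFun hw j
    simp only [oneFormAct, actMat, Matrix.of_apply] at this
    rw [LinearMap.comp_apply, LinearMap.coe_single, Fintype.linearCombination_apply_single,
      one_smul, ← this]
    simp only [LinearMap.comp_apply, LinearMap.coe_single, Fintype.linearCombination_apply,
      AlgHom.toLinearMap_apply, map_sum, map_smul, LinearEquiv.coe_coe]
    exact Finset.sum_congr rfl fun i _ => by rw [smul_eq_C_mul, mul_comm]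
  simpa using LinearMap.congr_fun key (g v)

/-- A linear map fixing the kernel of `z` pointwise differs from the identity by a rank one map. -/
lemma exists_eq_add_smul {z : (Fin n → F) →ₗ[F] F} (hz : z ≠ 0) {g : GLn F n}
    (hg : ∀ v ∈ LinearMap.ker z, g v = v) : ∃ a, ∀ v, g v = v + z v • a := by
  obtain ⟨u, hu⟩ := LinearMap.surjective hz 1
  refine ⟨g u - u, fun v => ?_⟩
  have := hg (v - z v • u) (by simp [hu])
  rw [map_sub, map_smul, sub_eq_iff_eq_add] at this
  rw [this, smul_sub]
  abel

lemma det_eq_one_add {z : (Fin n → F) →ₗ[F] F} {g : GLn F n} {a : Fin n → F}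
    (ha : ∀ v, g v = v + z v • a) : LinearMap.det g.toLinearMap = 1 + z a := by
  rw [← LinearMap.transvection.det z a]
  congr 1
  exact LinearMap.ext ha

lemma apply_eq_det_mul {z : (Fin n → F) →ₗ[F] F} (hz : z ≠ 0) {g : GLn F n}
    (hg : ∀ v ∈ LinearMap.ker z, g v = v) (v : Fin n → F) :
    z (g v) = LinearMap.det g.toLinearMap * z v := by
  obtain ⟨a, ha⟩ := exists_eq_add_smul hz hg
  rw [det_eq_one_add ha, ha]
  simp
  ring

lemma linToPoly_dvd_polyAct_sub {z : (Fin n → F) →ₗ[F] F} (hz : z ≠ 0) {g : GLn F n}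
    (hg : ∀ v ∈ LinearMap.ker z, g v = v) (p : MvPolynomial (Fin n) F) :
    linToPoly z ∣ polyAct g p - p := by
  obtain ⟨a, ha⟩ := exists_eq_add_smul hz (g := g.symm) fun v hv => by
    rw [LinearEquiv.symm_apply_eq, hg v hv]
  rw [← Ideal.mem_span_singleton, ← Ideal.Quotient.eq]
  have : (Ideal.Quotient.mkₐ F (Ideal.span {linToPoly z})).comp (polyAct g) =
      Ideal.Quotient.mkₐ F (Ideal.span {linToPoly z}) := by
    ext i
    simp only [AlgHom.comp_apply, Ideal.Quotient.mkₐ_eq_mk]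
    rw [Ideal.Quotient.eq, Ideal.mem_span_singleton]
    refine ⟨C (a i), ?_⟩
    simp only [polyAct, aeval_X, actMat, Matrix.of_apply, ha, Pi.add_apply, Pi.smul_apply,
      smul_eq_mul, C_add, C_mul, add_mul, Finset.sum_add_distrib, linToPoly, Finset.sum_mul]
    rw [Finset.sum_eq_single i (by intro j _ h; simp [h.symm]) (by simp)]
    simp only [Pi.single_eq_same, C_1, one_mul, add_sub_cancel_left]
    exact Finset.sum_congr rfl fun j _ => by ring
  exact AlgHom.congr_fun this p

/-- A semi-invariant of a reflection is divisible by a power of the form defining its hyperplane. -/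
lemma linToPoly_pow_dvd_of_semiinvariant {z : (Fin n → F) →ₗ[F] F} (hz : z ≠ 0) {g : GLn F n}
    (hg : ∀ v ∈ LinearMap.ker z, g v = v) {p : MvPolynomial (Fin n) F} {m k₀ k : ℕ}
    (hp : polyAct g p = C (LinearMap.det g.toLinearMap ^ m) * p)
    (h₀ : linToPoly z ^ k₀ ∣ p)
    (hk : ∀ i, k₀ ≤ i → i < k → LinearMap.det g.toLinearMap ^ (m + i) ≠ 1) :
    linToPoly z ^ k ∣ p := by
  induction k with
  | zero => simp
  | succ k ih =>
    rcases le_or_gt (k + 1) k₀ with hle | hlt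
    · exact (pow_dvd_pow _ hle).trans h₀
    obtain ⟨q, rfl⟩ := ih fun i h h' => hk i h (h'.trans k.lt_succ_self)
    rw [pow_succ]
    refine mul_dvd_mul_left _ ?_
    set d := LinearMap.det g.toLinearMap with hd
    have hne : linToPoly z ≠ 0 := (irreducible_linToPoly hz).ne_zero
    have hz' : C d * polyAct g (linToPoly z) = linToPoly z := by
      rw [polyAct_linToPoly, linToPoly, linToPoly, Finset.mul_sum]
      refine Finset.sum_congr rfl fun j _ => ?_
      rw [← mul_assoc, ← C_mul, hd, LinearMap.comp_apply, ← apply_eq_det_mul hz hg]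
      simp
    have hq : polyAct g q = C (d ^ (m + k)) * q := by
      apply mul_left_cancel₀ (pow_ne_zero k hne)
      calc linToPoly z ^ k * polyAct g q
          = C d ^ k * polyAct g (linToPoly z ^ k * q) := by
            conv_lhs => rw [← hz']
            rw [map_mul, map_pow]; ring
        _ = linToPoly z ^ k * (C (d ^ (m + k)) * q) := by
            rw [hp]; simp only [map_pow]; ring
    have hdvd := linToPoly_dvd_polyAct_sub hz hg q
    have hu : d ^ (m + k) - 1 ≠ 0 := sub_ne_zero.2 (hk k (by omega) k.lt_succ_self)
    have : C (d ^ (m + k)) * q - q = C (d ^ (m + k) - 1) * q := by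
      rw [C_sub, C_1]; ring
    rw [hq, this] at hdvd
    exact ((isUnit_iff_ne_zero.2 hu).map C).dvd_mul_left.1 hdvd

/-- Some element of the pointwise stabilizer of `H` has determinant of order `e_H`. -/
lemma exists_orderOf_det_eq_eH (G : Subgroup (GLn F n)) [Finite G]
    (H : Submodule F (Fin n → F)) :
    0 < eH G H ∧ ∃ s ∈ pointStab G H, orderOf (LinearMap.det s.toLinearMap) = eH G H := by
  have hfin : Finite (pointStab G H) :=
    Finite.of_injective (Subgroup.inclusion (fun g hg => hg.1 : pointStab G H ≤ G))
      (Subgroup.inclusion_injective _)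
  let φ : pointStab G H →* Fˣ := LinearEquiv.det.comp (pointStab G H).subtype
  have hφ : (KH G H).subgroupOf (pointStab G H) = φ.ker := by
    ext g
    simp [KH, Subgroup.mem_subgroupOf, φ, MonoidHom.mem_ker]
  have he : eH G H = Nat.card φ.range := by rw [eH, hφ, Subgroup.index_ker]
  have : Finite φ.range := Set.finite_range φ
  refine ⟨he ▸ Nat.card_pos, ?_⟩
  obtain ⟨⟨_, s, rfl⟩, hs⟩ := IsCyclic.exists_ofOrder_eq_natCard (α := φ.range)
  refine ⟨s, s.2, ?_⟩
  rw [he, ← hs, ← Subgroup.orderOf_coe, ← orderOf_units]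
  simp [φ]

/-- A matrix product whose `j`-th column is divisible by `p ^ k j` has determinant divisible by
the product of these powers. -/
lemma prod_pow_dvd_det {ι R : Type*} [Fintype ι] [DecidableEq ι] [CommRing R] (p : R) (k : ι → ℕ)
    (M : Matrix ι ι R) (h : ∀ i j, p ^ k j ∣ M i j) : p ^ ∑ j, k j ∣ M.det := by
  choose N hN using h
  have : M = Matrix.of fun i j => p ^ k j * Matrix.of N i j := by
    ext i j
    simp [hN]
  rw [this, Matrix.det_mul_row, Finset.prod_pow_eq_pow_sum]
  exact dvd_mul_right _ _

/-- The root vectors of transvections in `G_H`, together with an eigenvector outside `H`, extend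
to a basis. -/
lemma exists_basis_of_root_vectors {H T : Submodule F (Fin n → F)} {S : Set (Fin n → F)}
    (hS : Submodule.span F S = T) (hT : T ≤ H) {u : Fin n → F} (hu : u ∉ H) :
    ∃ (b : Module.Basis (Fin n) F (Fin n → F)) (i₀ : Fin n) (J : Finset (Fin n)),
      b i₀ = u ∧ i₀ ∉ J ∧ (∀ j ∈ J, b j ∈ S) ∧ J.card = Module.finrank F T := by
  classical
  obtain ⟨B, hBS, hBspan, hBli⟩ := exists_linearIndependent F S
  have hins : LinearIndepOn F id (insert u B) := by
    refine LinearIndepOn.insert hBli ?_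
    rw [Set.image_id, id, hBspan, hS]
    exact fun h => hu (hT h)
  let c := Module.Basis.extend hins
  have hsub : insert u B ⊆ hins.extend (Set.subset_univ _) := Module.Basis.subset_extend hins
  have : Fintype (hins.extend (Set.subset_univ (insert u B))) := FiniteDimensional.fintypeBasisIndex c
  have hcard : Fintype.card (hins.extend (Set.subset_univ (insert u B))) = n := by
    rw [← Module.finrank_eq_card_basis c, Module.finrank_fin_fun]
  let e := Fintype.equivFinOfCardEq hcard
  have huB : u ∉ B := fun h => hu (hT (hS ▸ Submodule.subset_span (hBS h)))
  have hbe : ∀ x, c.reindex e (e x) = x := fun x => by simp [c]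
  have hfin : B.Finite := hBli.setFinite
  have : Fintype B := hfin.fintype
  let f : B → Fin n := fun x => e ⟨x, hsub (Set.mem_insert_of_mem _ x.2)⟩
  have hf : Function.Injective f := fun x y h => by
    have := congrArg Subtype.val (e.injective h)
    exact Subtype.ext this
  refine ⟨c.reindex e, e ⟨u, hsub (Set.mem_insert _ _)⟩, Finset.univ.image f, hbe _, ?_, ?_, ?_⟩
  · simp only [Finset.mem_image, Finset.mem_univ, true_and, not_exists]
    intro x hx
    have := congrArg Subtype.val (e.injective hx)
    exact huB ((show (x : Fin n → F) = u from this) ▸ x.2)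
  · simp only [Finset.mem_image, Finset.mem_univ, true_and, forall_exists_index,
      forall_apply_eq_imp_iff]
    exact fun x => by rw [hbe]; exact hBS x.2
  · rw [Finset.card_image_of_injective _ hf, Finset.card_univ, ← hS, ← hBspan,
      finrank_span_set_eq_card hBli, Set.toFinset_card]

/-- The divisibility at a single hyperplane. -/
lemma linToPoly_pow_dvd_det (G : Subgroup (GLn F n)) [Finite G] {H : Submodule F (Fin n → F)}
    {z : (Fin n → F) →ₗ[F] F} (hz : z ≠ 0) (hH : LinearMap.ker z = H)
    (ω : Fin n → Fin n → MvPolynomial (Fin n) F)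
    (hω : ∀ i, ∀ g ∈ G, oneFormAct g (ω i) = ω i) :
    linToPoly z ^ (eH G H * bH G H + eH G H - 1) ∣ Matrix.det (Matrix.of fun i j => ω i j) := by
  classical
  subst hH
  set H := LinearMap.ker z
  set e := eH G H
  obtain ⟨he, s, u, hs, hord, huH, hu⟩ : 0 < e ∧ ∃ s u, s ∈ pointStab G H ∧
      orderOf (LinearMap.det s.toLinearMap) = e ∧ u ∉ H ∧
      s u = LinearMap.det s.toLinearMap • u := by
    obtain ⟨he, s, hs, hord⟩ := exists_orderOf_det_eq_eH G H
    obtain ⟨a, ha⟩ := exists_eq_add_smul hz hs.2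
    refine ⟨he, ?_⟩
    by_cases hza : z a = 0
    · obtain ⟨u, hu⟩ := LinearMap.surjective hz 1
      rw [det_eq_one_add ha, hza, add_zero] at hord
      have h1 : LinearMap.det (1 : GLn F n).toLinearMap = 1 := LinearMap.det_id
      exact ⟨1, u, one_mem _, by rw [h1, hord], by simp [H, hu], by rw [h1, one_smul]; rfl⟩
    · exact ⟨s, a, hs, hord, hza, by rw [det_eq_one_add ha, ha, add_smul, one_smul]⟩
  have hequiv : ∀ i, ∀ g ∈ G, ∀ v, Fintype.linearCombination F (ω i) (g v) =
      polyAct g (Fintype.linearCombination F (ω i) v) :=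
    fun i g hg => linearCombination_apply_of_invariant (hω i g hg)
  have hpow : ∀ i, 0 < i → i < e → LinearMap.det s.toLinearMap ^ i ≠ 1 := fun i h h' =>
    pow_ne_one_of_lt_orderOf h.ne' (hord ▸ h')
  let S : Set (Fin n → F) :=
    {x | ∃ g, (g ∈ pointStab G H ∧ IsTransvection g) ∧ ∃ v, g v - v = x}
  have hSspan : Submodule.span F S = trvSpace G H := by
    apply le_antisymm
    · rw [Submodule.span_le]
      rintro _ ⟨g, hg, v, rfl⟩
      exact Submodule.mem_iSup_of_mem g (Submodule.mem_iSup_of_mem hg ⟨v, rfl⟩)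
    · refine iSup₂_le fun g hg => ?_
      rintro _ ⟨v, rfl⟩
      exact Submodule.subset_span ⟨g, hg, v, rfl⟩
  have hSH : S ⊆ H := by
    rintro _ ⟨g, ⟨hg, ht⟩, v, rfl⟩
    simp [H, apply_eq_det_mul hz hg.2, ht.2.1]
  obtain ⟨b, i₀, J, hi₀, hi₀J, hJ, hcard⟩ :=
    exists_basis_of_root_vectors hSspan (hSspan ▸ Submodule.span_le.2 hSH) huH
  let k : Fin n → ℕ := fun j => (if j ∈ J then e else 0) + (if j = i₀ then e - 1 else 0)
  have hk : ∑ j, k j = e * bH G H + e - 1 := by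
    have : J.card = bH G H := hcard
    simp only [k, Finset.sum_add_distrib, Finset.sum_ite_mem, Finset.univ_inter,
      Finset.sum_const, Finset.sum_ite_eq', Finset.mem_univ, if_true, smul_eq_mul, this]
    rw [mul_comm, Nat.add_sub_assoc he]
  let P : Matrix (Fin n) (Fin n) F := Matrix.of fun l j => b j l
  let M : Matrix (Fin n) (Fin n) (MvPolynomial (Fin n) F) :=
    Matrix.of fun i j => Fintype.linearCombination F (ω i) (b j)
  have hM : M = (Matrix.of fun i j => ω i j) * P.map C := by
    ext1 i j
    simp only [M, P, Matrix.of_apply, Fintype.linearCombination_apply, Matrix.mul_apply,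
      Matrix.map_apply]
    exact Finset.sum_congr rfl fun l _ => by rw [smul_eq_C_mul, mul_comm]
  have hP : IsUnit (P.map (C (σ := Fin n))).det := by
    have h1 : P = (Pi.basisFun F (Fin n)).toMatrix b := by
      ext i j
      simp [P, Module.Basis.toMatrix_apply]
    have h2 : IsUnit P.det := by
      rw [h1, ← Module.Basis.det_apply]
      exact (Pi.basisFun F (Fin n)).isUnit_det b
    rw [← RingHom.mapMatrix_apply, ← RingHom.map_det]
    exact h2.map C
  have hdvd : linToPoly z ^ ∑ j, k j ∣ M.det := by
    refine prod_pow_dvd_det _ _ _ fun i j => ?_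
    simp only [M, Matrix.of_apply, k]
    by_cases hj : j ∈ J
    · have hji : j ≠ i₀ := fun h => hi₀J (h ▸ hj)
      simp only [hj, hji, if_true, if_false, add_zero]
      have hbH := hSH (hJ j hj)
      have hinv : polyAct s (Fintype.linearCombination F (ω i) (b j)) =
          C (LinearMap.det s.toLinearMap ^ 0) * Fintype.linearCombination F (ω i) (b j) := by
        rw [← hequiv i s hs.1, hs.2 _ hbH]
        simp
      refine linToPoly_pow_dvd_of_semiinvariant hz hs.2 hinv (k₀ := 1) ?_ fun l hl hle => ?_
      · obtain ⟨g, ⟨hg, -⟩, v, hv⟩ := hJ j hj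
        rw [← hv, map_sub, hequiv i g hg.1, pow_one]
        exact linToPoly_dvd_polyAct_sub hz hg.2 _
      · rw [zero_add]
        exact hpow l hl hle
    · by_cases hji : j = i₀
      · subst hji
        simp only [hj, if_true, if_false, zero_add]
        have hinv : polyAct s (Fintype.linearCombination F (ω i) (b j)) =
            C (LinearMap.det s.toLinearMap ^ 1) * Fintype.linearCombination F (ω i) (b j) := by
          rw [← hequiv i s hs.1, hi₀, hu, map_smul, smul_eq_C_mul, pow_one]
        refine linToPoly_pow_dvd_of_semiinvariant hz hs.2 hinv (k₀ := 0) (by simp)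
          fun l _ hle => hpow _ (by omega) (by omega)
      · simp [hj, hji]
  rw [hk, hM, Matrix.det_mul] at hdvd
  exact hP.dvd_mul_right.1 hdvd

/-- for a finite reflection group `G` with reflection arrangement `A`
and invariant 1-forms `ω₁,…,ωₙ`, the polynomial
`Q(Ã)·Q_det = ∏_{H ∈ A} l_H^{e_H b_H + e_H - 1}` divides the polynomial `f` with
`ω₁ ∧ ⋯ ∧ ωₙ = f · vol`. -/
theorem stmt7 {F : Type*} [Field F] (h2 : ringChar F ≠ 2) {n : ℕ}
    (G : Subgroup (GLn F n)) [Finite G]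
    (hrefl : Subgroup.closure {g : GLn F n | g ∈ G ∧ IsReflection g} = G)
    (A : Finset (Submodule F (Fin n → F)))
    (hA : ∀ H, H ∈ A ↔ ∃ g ∈ G, IsReflection g ∧ fixedSpace g = H)
    (ℓ : Submodule F (Fin n → F) → ((Fin n → F) →ₗ[F] F))
    (hℓ : ∀ H ∈ A, ℓ H ≠ 0 ∧ LinearMap.ker (ℓ H) = H)
    (ω : Fin n → Fin n → MvPolynomial (Fin n) F)
    (hω : ∀ i, ∀ g ∈ G, oneFormAct g (ω i) = ω i) :
    (∏ H ∈ A, linToPoly (ℓ H) ^ (eH G H * bH G H + eH G H - 1)) ∣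
      Matrix.det (Matrix.of fun i j => ω i j) := by
  refine Finset.prod_dvd_of_isRelPrime (fun H hH H' hH' hne => ?_) fun H hH =>
    linToPoly_pow_dvd_det G (hℓ H hH).1 (hℓ H hH).2 ω hω
  refine (isRelPrime_linToPoly (hℓ H hH).1 (hℓ H' hH').1 ?_).pow
  rwa [(hℓ H hH).2, (hℓ H' hH').2]
end

section
/- Let F_q be a finite field, V = F_qⁿ with dual basis z₁,...,zₙ, and for 1 ≤ k ≤ n define f_k := ∏_{(α₁,...,α_{k−1}) ∈ F_q^{k−1}} (z_k + α_{k−1}z_{k−1} + ... + α₁z₁). Then each f_k is invariant under the unipotent group U_n(F_q) of lower triangular matrices with 1's on the diagonal, the f_k are algebraically independent, and F[V]^{U_n(F_q)} = F_q[f₁,...,fₙ]. -/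
open MvPolynomial

variable {F : Type*} [Field F] {n : ℕ}

/-- The basic invariant `f_k = ∏_{α ∈ F^{k}} (z_k + α_{k-1} z_{k-1} + ⋯ + α_0 z_0)`
of the unipotent group (indices 0-based). -/
noncomputable def unipBasic (F : Type*) [Field F] [Fintype F] (n : ℕ) (k : Fin n) :
    MvPolynomial (Fin n) F :=
  ∏ α : Fin (k : ℕ) → F,
    (X k + ∑ i : Fin (k : ℕ), C (α i) * X (Fin.castLE k.isLt.le i))

/-- The linear form `∑ i, α i z_i` in the coordinates preceding `z_k`. -/
noncomputable def lowerForm (k : Fin n) (α : Fin (k : ℕ) → F) : MvPolynomial (Fin n) F :=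
  ∑ i : Fin (k : ℕ), C (α i) * X (Fin.castLE k.isLt.le i)

/-- The space of linear forms in the coordinates preceding `z_k`. -/
noncomputable def lowerSpan (F : Type*) [Field F] {n : ℕ} (k : Fin n) :
    Submodule F (MvPolynomial (Fin n) F) :=
  Submodule.span F (X '' Set.Iio k)

/-- The substitution `z_k ↦ p`. -/
noncomputable def substVar (k : Fin n) (p : MvPolynomial (Fin n) F) :
    MvPolynomial (Fin n) F →ₐ[F] MvPolynomial (Fin n) F :=
  aeval (Function.update X k p)

lemma X_mem_lowerSpan {i k : Fin n} (h : i < k) : (X i : MvPolynomial (Fin n) F) ∈ lowerSpan F k :=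
  Submodule.subset_span ⟨i, h, rfl⟩

lemma lowerSpan_mono {i k : Fin n} (h : i ≤ k) : lowerSpan F i ≤ lowerSpan F k :=
  Submodule.span_mono (Set.image_mono (Set.Iio_subset_Iio h))

lemma lowerForm_mem (k : Fin n) (α : Fin (k : ℕ) → F) : lowerForm k α ∈ lowerSpan F k := by
  refine Submodule.sum_mem _ fun i _ => ?_
  rw [← smul_eq_C_mul]
  exact Submodule.smul_mem _ _ (X_mem_lowerSpan (Fin.lt_def.2 i.isLt))

lemma exists_lowerForm_eq {k : Fin n} {l : MvPolynomial (Fin n) F} (hl : l ∈ lowerSpan F k) :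
    ∃ α, lowerForm k α = l := by
  induction hl using Submodule.span_induction with
  | mem x hx =>
    obtain ⟨i, hi, rfl⟩ := hx
    refine ⟨Pi.single ⟨i, hi⟩ 1, ?_⟩
    rw [lowerForm, Finset.sum_eq_single ⟨i, hi⟩]
    · simp only [Pi.single_eq_same, C_1, one_mul]
      rfl
    · intro j _ hj
      simp [hj]
    · simp
  | zero => exact ⟨0, by simp [lowerForm]⟩
  | add x y _ _ hx hy =>
    obtain ⟨a, rfl⟩ := hx
    obtain ⟨b, rfl⟩ := hy
    exact ⟨a + b, by simp [lowerForm, add_mul, Finset.sum_add_distrib]⟩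
  | smul c x _ hx =>
    obtain ⟨a, rfl⟩ := hx
    exact ⟨c • a, by simp [lowerForm, smul_eq_C_mul, Finset.mul_sum, mul_assoc]⟩

lemma lowerForm_injective (k : Fin n) : Function.Injective (lowerForm (F := F) k) := by
  intro α β h
  ext i
  have := congrArg (coeff (Finsupp.single (Fin.castLE k.isLt.le i) 1)) h
  simpa [lowerForm, coeff_sum, coeff_C_mul, coeff_X, Finsupp.single_left_inj,
    (Fin.castLE_injective k.isLt.le).eq_iff] using this

@[simp] lemma substVar_X_self (k : Fin n) (p : MvPolynomial (Fin n) F) :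
    substVar k p (X k) = p := by
  simp [substVar]

lemma substVar_X_of_ne {i k : Fin n} (h : i ≠ k) (p : MvPolynomial (Fin n) F) :
    substVar k p (X i) = X i := by
  simp [substVar, h]

lemma substVar_of_mem_lowerSpan (k : Fin n) (p : MvPolynomial (Fin n) F)
    {l : MvPolynomial (Fin n) F} (hl : l ∈ lowerSpan F k) : substVar k p l = l := by
  have : Set.EqOn (substVar k p).toLinearMap (LinearMap.id : MvPolynomial (Fin n) F →ₗ[F] _)
      (lowerSpan F k) := by
    apply LinearMap.eqOn_span
    rintro _ ⟨i, hi, rfl⟩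
    exact substVar_X_of_ne (ne_of_lt hi) p
  exact this hl

lemma X_sub_dvd_sub_substVar (k : Fin n) (p h : MvPolynomial (Fin n) F) :
    X k - p ∣ h - substVar k p h := by
  rw [← Ideal.mem_span_singleton, ← Ideal.Quotient.eq]
  have : (Ideal.Quotient.mkₐ F (Ideal.span {X k - p})) =
      (Ideal.Quotient.mkₐ F (Ideal.span {X k - p})).comp (substVar k p) := by
    apply algHom_ext
    intro i
    by_cases hi : i = k
    · subst hi
      simp only [AlgHom.comp_apply, substVar_X_self, Ideal.Quotient.mkₐ_eq_mk]
      rw [Ideal.Quotient.eq, Ideal.mem_span_singleton]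
    · simp only [AlgHom.comp_apply, substVar_X_of_ne hi]
  exact DFunLike.congr_fun this h

lemma X_add_dvd_iff {k : Fin n} {l : MvPolynomial (Fin n) F} (hl : l ∈ lowerSpan F k)
    (h : MvPolynomial (Fin n) F) : X k + l ∣ h ↔ substVar k (-l) h = 0 := by
  constructor
  · rintro ⟨q, rfl⟩
    simp [substVar_of_mem_lowerSpan k _ hl]
  · intro h0
    simpa [h0] using X_sub_dvd_sub_substVar k (-l) h

lemma X_add_ne_zero {k : Fin n} {l : MvPolynomial (Fin n) F} (hl : l ∈ lowerSpan F k) :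
    X k + l ≠ 0 := by
  intro h
  have := congrArg (substVar k (1 - l)) h
  simp [substVar_of_mem_lowerSpan k _ hl] at this

lemma prime_X_add {k : Fin n} {l : MvPolynomial (Fin n) F} (hl : l ∈ lowerSpan F k) :
    Prime (X k + l) := by
  refine ⟨X_add_ne_zero hl, fun h => ?_, fun a b => ?_⟩
  · have := (X_add_dvd_iff hl 1).1 (isUnit_iff_dvd_one.1 h)
    simp at this
  · simp only [X_add_dvd_iff hl, map_mul, mul_eq_zero, imp_self]

lemma isRelPrime_X_add {k : Fin n} {l m : MvPolynomial (Fin n) F} (hl : l ∈ lowerSpan F k)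
    (hm : m ∈ lowerSpan F k) (h : l ≠ m) : IsRelPrime (X k + l) (X k + m) := by
  rw [(prime_X_add hl).irreducible.isRelPrime_iff_not_dvd, X_add_dvd_iff hl]
  simp only [map_add, substVar_X_self, substVar_of_mem_lowerSpan k _ hm]
  intro h0
  exact h (neg_add_eq_zero.1 h0)

lemma polyAct_X (g : GLn F n) (i : Fin n) :
    polyAct g (X i) = ∑ j, C (actMat g i j) * X j := by
  simp [polyAct]

lemma actMat_eq_toMatrix (g : GLn F n) : actMat g = LinearMap.toMatrix' g.symm.toLinearMap := by
  ext i j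
  simp [actMat, LinearMap.toMatrix'_apply]

lemma polyAct_polyAct_inv (g : GLn F n) (p : MvPolynomial (Fin n) F) :
    polyAct g (polyAct g⁻¹ p) = p := by
  have hM : actMat g⁻¹ * actMat g = 1 := by
    rw [actMat_eq_toMatrix, actMat_eq_toMatrix, ← LinearMap.toMatrix'_comp,
      ← LinearMap.toMatrix'_id]
    congr 1
    ext1 v
    exact LinearMap.ext fun x => g.apply_symm_apply _
  have : (polyAct g).comp (polyAct g⁻¹) = AlgHom.id F _ := by
    apply algHom_ext
    intro i
    simp only [AlgHom.comp_apply, polyAct_X, map_sum, map_mul, AlgHom.id_apply,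
      algHom_C, algebraMap_eq, Finset.mul_sum]
    rw [Finset.sum_comm]
    have hi : ∀ j, ∑ x, C (actMat g⁻¹ i x) * (C (actMat g x j) * X j) =
        C ((1 : Matrix (Fin n) (Fin n) F) i j) * X j := by
      intro j
      simp only [← hM, Matrix.mul_apply, map_sum, Finset.sum_mul, map_mul, mul_assoc]
    simp only [hi]
    simp [Matrix.one_apply]
  exact DFunLike.congr_fun this p

lemma polyAct_injective (g : GLn F n) : Function.Injective (polyAct g) := by
  refine Function.LeftInverse.injective (g := polyAct g⁻¹) fun p => ?_
  simpa using polyAct_polyAct_inv g⁻¹ p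

/-- `g` acts on the coordinates by a lower unitriangular matrix. -/
def IsUnitriangularAct (g : GLn F n) : Prop :=
  ∀ k : Fin n, polyAct g (X k) - X k ∈ lowerSpan F k

lemma isUnitriangularAct_of_symm {g : GLn F n}
    (h0 : ∀ i j : Fin n, i < j → g.symm (Pi.single j 1) i = 0)
    (h1 : ∀ i : Fin n, g.symm (Pi.single i 1) i = 1) : IsUnitriangularAct g := by
  intro k
  have hk : polyAct g (X k) - X k = ∑ j ∈ Finset.univ.erase k, C (actMat g k j) * X j := by
    rw [polyAct_X, ← Finset.add_sum_erase _ _ (Finset.mem_univ k)]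
    simp [actMat, h1]
  rw [hk]
  refine Submodule.sum_mem _ fun j hj => ?_
  rcases lt_or_gt_of_ne (Finset.ne_of_mem_erase hj) with h | h
  · rw [← smul_eq_C_mul]
    exact Submodule.smul_mem _ _ (X_mem_lowerSpan h)
  · simp [actMat, h0 k j h]

lemma IsUnitriangularAct.map_lowerSpan {g : GLn F n} (hg : IsUnitriangularAct g) {k : Fin n}
    {l : MvPolynomial (Fin n) F} (hl : l ∈ lowerSpan F k) : polyAct g l ∈ lowerSpan F k := by
  induction hl using Submodule.span_induction with
  | mem x hx =>
    obtain ⟨i, hi, rfl⟩ := hx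
    rw [← sub_add_cancel (polyAct g (X i)) (X i)]
    exact Submodule.add_mem _ (lowerSpan_mono (le_of_lt hi) (hg i)) (X_mem_lowerSpan hi)
  | zero => simp
  | add x y _ _ hx hy => rw [map_add]; exact Submodule.add_mem _ hx hy
  | smul c x _ hx => rw [map_smul]; exact Submodule.smul_mem _ _ hx

lemma IsUnitriangularAct.polyAct_unipBasic [Fintype F] {g : GLn F n} (hg : IsUnitriangularAct g)
    (k : Fin n) : polyAct g (unipBasic F n k) = unipBasic F n k := by
  have he : ∀ α : Fin (k : ℕ) → F, ∃ β : Fin (k : ℕ) → F,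
      X k + lowerForm k β = polyAct g (X k + lowerForm k α) := by
    intro α
    obtain ⟨β, hβ⟩ := exists_lowerForm_eq
      (Submodule.add_mem _ (hg k) (hg.map_lowerSpan (lowerForm_mem k α)))
    refine ⟨β, ?_⟩
    rw [hβ, map_add]
    ring
  choose e he using he
  have hinj : Function.Injective e := by
    intro α β h
    have := he α
    rw [h, he β] at this
    exact (lowerForm_injective k (add_left_cancel (polyAct_injective g this))).symm
  change polyAct g (∏ α, (X k + lowerForm k α)) = ∏ α, (X k + lowerForm k α)
  rw [map_prod, ← (Finite.injective_iff_bijective.1 hinj).prod_comp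
    (fun α => X k + lowerForm k α)]
  exact Finset.prod_congr rfl fun α _ => (he α).symm

lemma unipBasic_dvd [Fintype F] {k : Fin n} {h : MvPolynomial (Fin n) F}
    (hl : ∀ l ∈ lowerSpan F k, substVar k l h = 0) : unipBasic F n k ∣ h := by
  change ∏ α, (X k + lowerForm k α) ∣ h
  refine Finset.prod_dvd_of_isRelPrime ?_ fun α _ => ?_
  · intro α _ β _ hαβ
    exact isRelPrime_X_add (lowerForm_mem k α) (lowerForm_mem k β)
      ((lowerForm_injective k).ne hαβ)
  · exact (X_add_dvd_iff (lowerForm_mem k α) h).2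
      (hl _ (Submodule.neg_mem _ (lowerForm_mem k α)))

lemma unipBasic_ne_zero [Fintype F] (k : Fin n) : unipBasic F n k ≠ 0 :=
  Finset.prod_ne_zero_iff.2 fun α _ => X_add_ne_zero (lowerForm_mem k α)

lemma degreeOf_unipBasic_pos [Fintype F] (k : Fin n) : 0 < degreeOf k (unipBasic F n k) := by
  obtain ⟨q, hq⟩ : X k ∣ unipBasic F n k := by
    have : X k + lowerForm k 0 ∣ ∏ α : Fin (k : ℕ) → F, (X k + lowerForm k α) :=
      Finset.dvd_prod_of_mem (fun α => X k + lowerForm k α) (Finset.mem_univ _)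
    rwa [show lowerForm k (0 : Fin (k : ℕ) → F) = 0 by simp [lowerForm], add_zero] at this
  have h0 := unipBasic_ne_zero (F := F) k
  rw [hq] at h0 ⊢
  rw [degreeOf_mul_eq (left_ne_zero_of_mul h0) (right_ne_zero_of_mul h0)]
  simp [degreeOf_X_self]

/-- The transvection whose contragredient action is `z_k ↦ z_k + ∑ i, α i z_i`. -/
lemma exists_translation (k : Fin n) (α : Fin (k : ℕ) → F) :
    ∃ g : GLn F n, (∀ i j : Fin n, i < j → g (Pi.single j 1) i = 0) ∧
      (∀ i : Fin n, g (Pi.single i 1) i = 1) ∧ polyAct g (X k) = X k + lowerForm k α ∧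
      ∀ i, i ≠ k → polyAct g (X i) = X i := by
  let φ : Module.Dual F (Fin n → F) :=
    -∑ i : Fin (k : ℕ), α i • LinearMap.proj (Fin.castLE k.isLt.le i)
  have hφ : ∀ j, k ≤ j → φ (Pi.single j 1) = 0 := by
    intro j hj
    simp only [φ, LinearMap.neg_apply, LinearMap.sum_apply, LinearMap.smul_apply,
      LinearMap.proj_apply, neg_eq_zero]
    refine Finset.sum_eq_zero fun i _ => ?_
    have : Fin.castLE k.isLt.le i ≠ j := ne_of_lt (lt_of_lt_of_le (Fin.lt_def.2 i.isLt) hj)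
    simp [this]
  have hφα : ∀ i : Fin (k : ℕ), φ (Pi.single (Fin.castLE k.isLt.le i) 1) = -α i := by
    intro i
    simp [φ, Pi.single_apply, (Fin.castLE_injective k.isLt.le).eq_iff]
  let g : GLn F n := LinearEquiv.transvection (hφ k le_rfl)
  have hg : ∀ x i, g x i = x i + φ x * (Pi.single k 1 : Fin n → F) i := fun x i => rfl
  have hgs : ∀ x i, g.symm x i = x i + φ x * -(Pi.single k 1 : Fin n → F) i := fun x i => rfl
  refine ⟨g, ?_, ?_, ?_, ?_⟩
  · intro i j hij
    rw [hg, Pi.single_eq_of_ne hij.ne]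
    by_cases hik : i = k
    · rw [hφ j (hik ▸ hij.le)]
      simp
    · simp [hik]
  · intro i
    rw [hg]
    by_cases hik : i = k
    · subst hik
      simp [hφ i le_rfl]
    · simp [hik]
  · rw [polyAct_X]
    have hM : ∀ j, C (actMat g k j) * X j =
        (if j = k then X k else 0) + C (-φ (Pi.single j 1)) * (X j : MvPolynomial (Fin n) F) := by
      intro j
      have : actMat g k j = (if j = k then 1 else 0) + -φ (Pi.single j 1) := by
        simp [actMat, hgs, Pi.single_apply, eq_comm]
      rw [this, C_add, add_mul]
      split_ifs with h <;> simp [h]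
    simp only [hM, Finset.sum_add_distrib, Finset.sum_ite_eq', Finset.mem_univ, if_true]
    congr 1
    symm
    refine Finset.sum_of_injOn (Fin.castLE k.isLt.le) (Fin.castLE_injective _).injOn
      (fun _ _ => Finset.mem_coe.2 (Finset.mem_univ _)) ?_ ?_
    · intro j _ hj
      have hkj : k ≤ j := by
        by_contra! h
        exact hj ⟨⟨j, h⟩, by simp, rfl⟩
      simp [hφ j hkj]
    · intro i _
      rw [hφα, neg_neg]
  · intro i hik
    rw [polyAct_X, Finset.sum_eq_single i]
    · simp [actMat, hgs, hik]
    · intro j _ hj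
      simp [actMat, hgs, hik, hj.symm]
    · simp

lemma substVar_eq_of_translation {g : GLn F n} {k : Fin n} {l : MvPolynomial (Fin n) F}
    (hl : l ∈ lowerSpan F k) (hk : polyAct g (X k) = X k + l)
    (hi : ∀ i, i ≠ k → polyAct g (X i) = X i) {h : MvPolynomial (Fin n) F}
    (hh : polyAct g h = h) : substVar k l h = substVar k 0 h := by
  have : (substVar k 0).comp (polyAct g) = substVar k l := by
    apply algHom_ext
    intro i
    by_cases hik : i = k
    · subst hik
      simp [hk, substVar_of_mem_lowerSpan i _ hl]
    · simp [hi i hik, substVar_X_of_ne hik]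
  rw [← this, AlgHom.comp_apply, hh]

lemma IsUnitriangularAct.polyAct_substVar_zero {g : GLn F n} (hg : IsUnitriangularAct g)
    (hg' : IsUnitriangularAct g⁻¹) {k : Fin n} {h : MvPolynomial (Fin n) F}
    (hs : h ∈ supported F (Set.Iic k)) (hh : polyAct g h = h)
    (hl : ∀ l ∈ lowerSpan F k, substVar k l h = substVar k 0 h) :
    polyAct g (substVar k 0 h) = substVar k 0 h := by
  set l := X k - polyAct g⁻¹ (X k) with hldef
  have hlm : l ∈ lowerSpan F k := by
    rw [hldef, ← neg_sub]
    exact Submodule.neg_mem _ (hg' k)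
  have hgl : polyAct g l = polyAct g (X k) - X k := by
    rw [hldef, map_sub, polyAct_polyAct_inv]
  have key : ((polyAct g).comp (substVar k l)) h = ((substVar k 0).comp (polyAct g)) h := by
    refine hom_congr_vars (f₁ := ((polyAct g).comp (substVar k l)).toRingHom)
      (f₂ := ((substVar k 0).comp (polyAct g)).toRingHom) ?_ ?_ rfl
    · ext c
      simp
    · intro i hi _
      have hik : i ≤ k := mem_supported.1 hs hi
      change polyAct g (substVar k l (X i)) = substVar k 0 (polyAct g (X i))
      have hx : polyAct g (X i) = X i + (polyAct g (X i) - X i) := by ring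
      rcases hik.eq_or_lt with rfl | hik
      · rw [substVar_X_self, hgl, hx, map_add, substVar_of_mem_lowerSpan _ _ (hg i)]
        simp
      · rw [substVar_X_of_ne hik.ne, hx, map_add, substVar_X_of_ne hik.ne,
          substVar_of_mem_lowerSpan _ _ (lowerSpan_mono hik.le (hg i))]
  simpa only [AlgHom.comp_apply, hl l hlm, hh] using key

lemma substVar_zero_mem_supported {k : Fin n} {h : MvPolynomial (Fin n) F}
    (hs : h ∈ supported F (Set.Iic k)) : substVar k 0 h ∈ supported F (Set.Iio k) := by
  have : supported F (Set.Iic k) ≤ (supported F (Set.Iio k)).comap (substVar k 0) := by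
    rw [supported_eq_adjoin_X, Algebra.adjoin_le_iff]
    rintro _ ⟨i, hi, rfl⟩
    change substVar k 0 (X i) ∈ supported F (Set.Iio k)
    rcases (Set.mem_Iic.1 hi).eq_or_lt with rfl | hik
    · simp
    · rw [substVar_X_of_ne hik.ne]
      exact X_mem_supported.2 hik
  exact this hs

lemma mem_supported_iff_degreeOf {s : Set (Fin n)} {h : MvPolynomial (Fin n) F} :
    h ∈ supported F s ↔ ∀ i ∉ s, degreeOf i h = 0 := by
  rw [mem_supported]
  constructor
  · intro hs i hi
    by_contra h0
    exact hi (hs (mem_vars_iff_degreeOf_ne_zero.2 h0))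
  · intro hs i hi
    by_contra h0
    exact mem_vars_iff_degreeOf_ne_zero.1 hi (hs i h0)

lemma mem_supported_of_mul {s : Set (Fin n)} {p q : MvPolynomial (Fin n) F}
    (hp : p ≠ 0) (h : p * q ∈ supported F s) : q ∈ supported F s := by
  rcases eq_or_ne q 0 with rfl | hq
  · exact zero_mem _
  rw [mem_supported_iff_degreeOf] at h ⊢
  intro i hi
  have := h i hi
  rw [degreeOf_mul_eq hp hq] at this
  omega

lemma mem_adjoin_unipBasic_of_mem_supported_Iic [Fintype F] {G : Subgroup (GLn F n)} {k : Fin n}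
    (hG : ∀ g ∈ G, IsUnitriangularAct g)
    (htr : ∀ l ∈ lowerSpan F k, ∃ g ∈ G, polyAct g (X k) = X k + l ∧
      ∀ i, i ≠ k → polyAct g (X i) = X i)
    (ih : ∀ h ∈ supported F (Set.Iio k), h ∈ invSub G →
      h ∈ Algebra.adjoin F (Set.range (unipBasic F n)))
    {h : MvPolynomial (Fin n) F} (hs : h ∈ supported F (Set.Iic k)) (hh : h ∈ invSub G) :
    h ∈ Algebra.adjoin F (Set.range (unipBasic F n)) := by
  induction hd : degreeOf k h using Nat.strong_induction_on generalizing h with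
  | _ d ihd =>
  have hl : ∀ l ∈ lowerSpan F k, substVar k l h = substVar k 0 h := by
    intro l hl
    obtain ⟨g, hgG, hk, hi⟩ := htr l hl
    exact substVar_eq_of_translation hl hk hi (hh g hgG)
  have hs0 := substVar_zero_mem_supported hs
  have h0inv : substVar k 0 h ∈ invSub G := fun g hg =>
    (hG g hg).polyAct_substVar_zero (hG _ (G.inv_mem hg)) hs (hh g hg) hl
  have h0 := ih _ hs0 h0inv
  have hdeg0 : degreeOf k (substVar k 0 h) = 0 :=
    mem_supported_iff_degreeOf.1 hs0 k (lt_irrefl k)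
  have hdiff : ∀ p, substVar k p (substVar k 0 h) = substVar k 0 h := by
    intro p
    refine hom_congr_vars (f₁ := (substVar k p).toRingHom) 
      (f₂ := RingHom.id (MvPolynomial (Fin n) F)) ?_ ?_ rfl
    · ext c
      simp
    · intro i hi _
      exact substVar_X_of_ne (ne_of_lt (mem_supported.1 hs0 hi)) p
  obtain ⟨q, hq⟩ : unipBasic F n k ∣ h - substVar k 0 h := by
    refine unipBasic_dvd fun l hlm => ?_
    rw [map_sub, hl l hlm, hdiff, sub_self]
  rw [← sub_add_cancel h (substVar k 0 h), hq]
  refine Subalgebra.add_mem _ (Subalgebra.mul_mem _ (Algebra.subset_adjoin ⟨k, rfl⟩) ?_) h0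
  rcases eq_or_ne q 0 with rfl | hq0
  · exact zero_mem _
  have hf0 := unipBasic_ne_zero (F := F) k
  refine ihd (degreeOf k q) ?_ (h := q) ?_ ?_ rfl
  · have h1 := degreeOf_sub_le k h (substVar k 0 h)
    rw [hq, degreeOf_mul_eq hf0 hq0, hdeg0, hd] at h1
    have := degreeOf_unipBasic_pos (F := F) k
    omega
  · refine mem_supported_of_mul hf0 ?_
    rw [← hq]
    exact sub_mem hs (supported_mono Set.Iio_subset_Iic_self hs0)
  · intro g hg
    refine mul_left_cancel₀ hf0 ?_
    rw [← hq]
    conv_lhs => rw [← (hG g hg).polyAct_unipBasic k]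
    rw [← map_mul, ← hq, map_sub, hh g hg, h0inv g hg]

lemma IsIntegral.of_prod_add {R S ι : Type*} [CommRing R] [CommRing S] [Algebra R S] [Fintype ι]
    [Nonempty ι] {x : S} {l : ι → S} (hl : ∀ i, IsIntegral R (l i))
    (h : IsIntegral R (∏ i, (x + l i))) : IsIntegral R x := by
  nontriviality S
  let P : Polynomial (integralClosure R S) :=
    ∏ i, (Polynomial.X + Polynomial.C ⟨l i, hl i⟩)
  have hPm : P.Monic := Polynomial.monic_prod_of_monic _ _ fun i _ => Polynomial.monic_X_add_C _
  have hPd : P.natDegree = Fintype.card ι := by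
    rw [Polynomial.natDegree_prod_of_monic _ _ fun i _ => Polynomial.monic_X_add_C _]
    simp
  have hx : IsIntegral (integralClosure R S) x := by
    refine ⟨P - Polynomial.C ⟨_, h⟩, ?_, ?_⟩
    · refine hPm.sub_of_left (lt_of_le_of_lt Polynomial.degree_C_le ?_)
      rw [← Polynomial.natDegree_pos_iff_degree_pos, hPd]
      exact Fintype.card_pos
    · rw [Polynomial.eval₂_sub, Polynomial.eval₂_finsetProd]
      simp only [Polynomial.eval₂_add, Polynomial.eval₂_X, Polynomial.eval₂_C]
      exact sub_self _
  exact isIntegral_trans x hx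

lemma X_isIntegral_adjoin_unipBasic [Fintype F] (k : Fin n) :
    IsIntegral (Algebra.adjoin F (Set.range (unipBasic F n))) (X k : MvPolynomial (Fin n) F) := by
  induction k using WellFoundedLT.induction with
  | ind k ih =>
  set A := Algebra.adjoin F (Set.range (unipBasic F n))
  have hC : ∀ c : F, IsIntegral A (C c : MvPolynomial (Fin n) F) := fun c =>
    isIntegral_algebraMap (R := A) (A := MvPolynomial (Fin n) F) (x := algebraMap F A c)
  have hform : ∀ α : Fin (k : ℕ) → F, IsIntegral A (lowerForm k α) := fun α =>
    IsIntegral.sum _ fun i _ => (hC _).mul (ih _ (Fin.lt_def.2 i.isLt))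
  have hf : IsIntegral A (unipBasic F n k) :=
    isIntegral_algebraMap (R := A) (A := MvPolynomial (Fin n) F)
      (x := ⟨_, Algebra.subset_adjoin ⟨k, rfl⟩⟩)
  exact IsIntegral.of_prod_add hform hf

lemma algebraicIndependent_unipBasic (F : Type*) [Field F] [Fintype F] (n : ℕ) :
    AlgebraicIndependent F (unipBasic F n) := by
  have integral : Algebra.IsIntegral (Algebra.adjoin F (Set.range (unipBasic F n)))
      (MvPolynomial (Fin n) F) := by
    refine ⟨fun p => ?_⟩
    induction p using MvPolynomial.induction_on with
    | C c =>
      exact isIntegral_algebraMap (R := Algebra.adjoin F (Set.range (unipBasic F n)))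
        (A := MvPolynomial (Fin n) F) (x := algebraMap F _ c)
    | add p q hp hq => exact hp.add hq
    | mul_X p i hp => exact hp.mul (X_isIntegral_adjoin_unipBasic i)
  exact (Algebra.IsAlgebraic.isTranscendenceBasis_of_lift_le_trdeg_of_finite F (unipBasic F n)
    (by rw [MvPolynomial.trdeg_of_isDomain]; simp)).1

/-- the polynomials `f_k` are invariant under the unipotent group
`U_n(F_q)` of lower unitriangular matrices, algebraically independent, and generate
the invariant ring: `F[V]^{U_n(F_q)} = F_q[f₁,…,fₙ]`. -/
theorem stmt13 {F : Type*} [Field F] [Fintype F] {n : ℕ}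
    (G : Subgroup (GLn F n))
    (hG : ∀ g : GLn F n, g ∈ G ↔
      (∀ i j : Fin n, i < j → g (Pi.single j 1) i = 0) ∧
      (∀ i : Fin n, g (Pi.single i 1) i = 1)) :
    (∀ k : Fin n, unipBasic F n k ∈ invSub G) ∧
    AlgebraicIndependent F (unipBasic F n) ∧
    Algebra.adjoin F (Set.range (unipBasic F n)) = invSub G := by
  have hGact : ∀ g ∈ G, IsUnitriangularAct g := fun g hg =>
    isUnitriangularAct_of_symm ((hG _).1 (G.inv_mem hg)).1 ((hG _).1 (G.inv_mem hg)).2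
  have hinv : ∀ k : Fin n, unipBasic F n k ∈ invSub G := fun k g hg =>
    (hGact g hg).polyAct_unipBasic k
  have htr : ∀ k : Fin n, ∀ l ∈ lowerSpan F k, ∃ g ∈ G, polyAct g (X k) = X k + l ∧
      ∀ i, i ≠ k → polyAct g (X i) = X i := by
    intro k l hl
    obtain ⟨α, rfl⟩ := exists_lowerForm_eq hl
    obtain ⟨g, h0, h1, h⟩ := exists_translation k α
    exact ⟨g, (hG g).2 ⟨h0, h1⟩, h⟩
  have hgen : ∀ m : ℕ, ∀ h ∈ supported F {i : Fin n | (i : ℕ) < m}, h ∈ invSub G →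
      h ∈ Algebra.adjoin F (Set.range (unipBasic F n)) := by
    intro m
    induction m with
    | zero =>
      intro h hs _
      simp only [not_lt_zero, Set.ofPred_false, supported_empty] at hs
      exact bot_le (a := Algebra.adjoin F (Set.range (unipBasic F n))) hs
    | succ m ih =>
      intro h hs hh
      by_cases hm : m < n
      · refine mem_adjoin_unipBasic_of_mem_supported_Iic (k := ⟨m, hm⟩) hGact (htr _) ih ?_ hh
        exact supported_mono (fun i hi => Fin.le_def.2 (Nat.lt_succ_iff.1 hi)) hs
      · exact ih h (supported_mono (fun i _ => by simp; omega) hs) hh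
  refine ⟨hinv, algebraicIndependent_unipBasic F n, le_antisymm ?_ fun h hh => ?_⟩
  · rw [Algebra.adjoin_le_iff]
    rintro _ ⟨k, rfl⟩
    exact hinv k
  · exact hgen n h (mem_supported.2 fun i _ => i.isLt) hh
end
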